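/- Fix c ∈ {6, 7} and ε > 0. There exists a constant C > 0 such that for every sufficiently large integer n, J_{1,c} = ∫_0^1 |f_2(α) f_c(α)|^2 |f_{5,c}(α)|^4 dα ≤ C · P_2^{1+ε} · P_c · P_5^{2θ_c}. -/

import Mathlib

open MeasureTheory Finset

noncomputable section

/-- `e(x) = exp(2πix)`. -/
def e (x : ℝ) : ℂ := Complex.exp (2 * Real.pi * Complex.I * x)

/-- `P_k = n^(1/k)`. -/
def P (n k : ℕ) : ℝ := (n : ℝ) ^ ((k : ℝ))⁻¹

/-- `θ_6 = 5/6`, `θ_7 = 87/98`. -/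
def θ (c : ℕ) : ℝ := if c = 6 then 5 / 6 else 87 / 98

/-- `Θ_c = 2/3 + θ_c/5 + 1/6 + 1/c`. -/
def Θ (c : ℕ) : ℝ := 2 / 3 + θ c / 5 + 1 / 6 + ((c : ℝ))⁻¹

/-- `f_k(α) = Σ_{P_k/2 < p ≤ P_k, p prime} e(α p^k) log p`. -/
def f (n k : ℕ) (α : ℝ) : ℂ :=
  ∑ p ∈ (Finset.range (n + 1)).filter
      (fun p : ℕ => p.Prime ∧ P n k / 2 < (p : ℝ) ∧ (p : ℝ) ≤ P n k),
    e (α * (p : ℝ) ^ k) * (Real.log p)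

/-- `f_{5,c}(α) = Σ_{1 < p ≤ P_5^{θ_c}, p prime} e(α p^5) log p`. -/
def f5 (n c : ℕ) (α : ℝ) : ℂ :=
  ∑ p ∈ (Finset.range (n + 1)).filter
      (fun p : ℕ => p.Prime ∧ 1 < (p : ℝ) ∧ (p : ℝ) ≤ P n 5 ^ θ c),
    e (α * (p : ℝ) ^ 5) * (Real.log p)

/-- `F_c(α) = f_2(α)^2 f_3(α)^2 f_{5,c}(α) f_6(α) f_c(α)`. -/
def F (n c : ℕ) (α : ℝ) : ℂ :=
  f n 2 α ^ 2 * f n 3 α ^ 2 * f5 n c α * f n 6 α * f n c α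

/-- `S_k(q,a) = Σ_{x=1,(x,q)=1}^{q} e(a x^k / q)`. -/
def S (k q a : ℕ) : ℂ :=
  ∑ x ∈ (Finset.Icc 1 q).filter (fun x => Nat.gcd x q = 1),
    e ((a : ℝ) * (x : ℝ) ^ k / q)

/-- `v_k(β) = (1/k) Σ_{2^{-k} n < m ≤ n} m^{1/k-1} e(β m)`. -/
def v (n k : ℕ) (β : ℝ) : ℂ :=
  ((k : ℂ))⁻¹ *
    ∑ m ∈ (Finset.Icc 1 n).filter (fun m : ℕ => (n : ℝ) / 2 ^ k < (m : ℝ)),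
      ((m : ℝ) ^ ((k : ℝ)⁻¹ - 1) : ℝ) * e (β * m)

/-- `w_c(β) = v_2(β)^2 v_3(β)^2 v_6(β) v_c(β)`. -/
def w (n c : ℕ) (β : ℝ) : ℂ := v n 2 β ^ 2 * v n 3 β ^ 2 * v n 6 β * v n c β

/-- `U_c(q,a) = S_2(q,a)^2 S_3(q,a)^2 S_5(q,a) S_6(q,a) S_c(q,a)`. -/
def U (c q a : ℕ) : ℂ := S 2 q a ^ 2 * S 3 q a ^ 2 * S 5 q a * S 6 q a * S c q a

/-- `A_{n,c}(q) = Σ_{a=1,(a,q)=1}^{q} U_c(q,a) e(-a n / q)`. -/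
def A (n : ℤ) (c q : ℕ) : ℂ :=
  ∑ a ∈ (Finset.Icc 1 q).filter (fun a => Nat.gcd a q = 1),
    U c q a * e (-((a : ℝ) * (n : ℝ)) / q)

/-- The major arcs `𝔐`. -/
def Maj (n : ℕ) (B : ℝ) : Set ℝ :=
  {α | α ∈ Set.Icc (0 : ℝ) 1 ∧ ∃ a q : ℕ, a ≤ q ∧ 1 ≤ q ∧
    (q : ℝ) ≤ Real.log n ^ B ∧ Nat.gcd a q = 1 ∧
    |α - (a : ℝ) / q| ≤ Real.log n ^ B / n}

/-- `Q_c = n^{2/(3c²(c-1))}`. -/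
def Q (n c : ℕ) : ℝ := (n : ℝ) ^ (2 / (3 * (c : ℝ) ^ 2 * ((c : ℝ) - 1)))

/-- The arcs `𝕽_c`. -/
def R (n c : ℕ) : Set ℝ :=
  {α | α ∈ Set.Icc (0 : ℝ) 1 ∧ ∃ a q : ℕ, a ≤ q ∧ 1 ≤ q ∧
    (q : ℝ) ≤ Q n c ∧ Nat.gcd a q = 1 ∧ |(q : ℝ) * α - a| ≤ Q n c / n}

/-- `τ = 2^{-20}`. -/
def τ : ℝ := ((2 : ℝ) ^ (20 : ℕ))⁻¹

/-- The sets `𝓔_c`. -/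
def E (n c : ℕ) : Set ℝ :=
  {α | α ∈ Set.Icc (0 : ℝ) 1 ∧
    ‖f n c α‖ ≤ P n c ^ (if c = 6 then 1 - 24 * τ else 139 / 140 - 24 * τ)}

end

theorem div_bound (δ : ℝ) (hδ : 0 < δ) : ∃ C : ℝ, 1 ≤ C ∧ ∀ m : ℕ, m ≠ 0 →
    ((m.divisors.card : ℕ) : ℝ) ≤ C * (m : ℝ) ^ δ := by
  obtain ⟨M, hM⟩ := exists_nat_ge ((2 : ℝ) ^ (1 / δ))
  set κ : ℝ := min 1 (δ * Real.log 2) with hκ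
  have hlog : 0 < Real.log 2 := Real.log_pos (by norm_num)
  have hκ0 : 0 < κ := lt_min one_pos (mul_pos hδ hlog)
  have hκ1 : κ ≤ 1 := min_le_left _ _
  have hB1 : 1 ≤ κ⁻¹ := (one_le_inv₀ hκ0).2 hκ1
  refine ⟨κ⁻¹ ^ M, one_le_pow₀ hB1, fun m hm => ?_⟩
  rw [Nat.card_divisors hm]
  have hmfac : (m : ℝ) ^ δ = ∏ p ∈ m.primeFactors, ((p : ℝ) ^ (m.factorization p)) ^ δ := by
    rw [Real.finsetProd_rpow _ _ (fun i _ => by positivity)]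
    congr 1
    conv_lhs => rw [← Nat.prod_factorization_pow_eq_self hm]
    simp [Finsupp.prod]
  have hloc : ∀ p ∈ m.primeFactors, ((m.factorization p + 1 : ℕ) : ℝ) ≤
      (if p < M then κ⁻¹ else 1) * ((p : ℝ) ^ (m.factorization p)) ^ δ := by
    intro p hp
    have hp2 : (2 : ℝ) ≤ p := by exact_mod_cast (Nat.prime_of_mem_primeFactors hp).two_le
    set a := m.factorization p
    have e1 : ((p : ℝ) ^ a) ^ δ = ((p : ℝ) ^ δ) ^ a := by
      rw [← Real.rpow_natCast, ← Real.rpow_mul (by positivity), mul_comm, Real.rpow_mul (by positivity),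
        Real.rpow_natCast]
    rw [e1]
    split_ifs with h
    · have h1 : (2 : ℝ) ^ δ ≤ (p : ℝ) ^ δ := Real.rpow_le_rpow (by norm_num) hp2 hδ.le
      have h2 : ((2 : ℝ) ^ δ) ^ a ≤ ((p : ℝ) ^ δ) ^ a := pow_le_pow_left₀ (by positivity) h1 _
      have h3 : (a : ℝ) * (δ * Real.log 2) + 1 ≤ ((2 : ℝ) ^ δ) ^ a := by
        rw [← Real.rpow_natCast, ← Real.rpow_mul (by norm_num), Real.rpow_def_of_pos (by norm_num)]
        have := Real.add_one_le_exp (Real.log 2 * (δ * a))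
        linarith
      rw [inv_mul_eq_div, le_div_iff₀ hκ0]
      have h4 : κ ≤ δ * Real.log 2 := min_le_right _ _
      have h5 : (a : ℝ) * κ ≤ a * (δ * Real.log 2) := mul_le_mul_of_nonneg_left h4 (by positivity)
      push_cast
      nlinarith
    · rw [one_mul]
      have h1 : (2 : ℝ) ≤ (p : ℝ) ^ δ := by
        have : (2 : ℝ) ^ (1 / δ) ≤ p := hM.trans (by exact_mod_cast not_lt.1 h)
        calc (2 : ℝ) = ((2 : ℝ) ^ (1 / δ)) ^ δ := by
              rw [← Real.rpow_mul (by norm_num)]; field_simp; simp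
          _ ≤ _ := Real.rpow_le_rpow (by positivity) this hδ.le
      have h2 : (2 : ℝ) ^ a ≤ ((p : ℝ) ^ δ) ^ a := pow_le_pow_left₀ (by positivity) h1 _
      have h3 : ((a + 1 : ℕ) : ℝ) ≤ (2 : ℝ) ^ a := by exact_mod_cast Nat.lt_two_pow_self
      exact h3.trans h2
  push_cast [Nat.cast_prod]
  calc _ ≤ ∏ p ∈ m.primeFactors, ((if p < M then κ⁻¹ else 1) * ((p : ℝ) ^ (m.factorization p)) ^ δ) := by
        apply Finset.prod_le_prod
        · intros; positivity
        · intro i hi; simpa using hloc i hi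
    _ = (∏ p ∈ m.primeFactors, (if p < M then κ⁻¹ else 1)) * (m : ℝ) ^ δ := by
        rw [Finset.prod_mul_distrib, hmfac]
    _ ≤ _ := by
        apply mul_le_mul_of_nonneg_right _ (by positivity)
        rw [Finset.prod_ite]
        simp only [prod_const, one_pow, mul_one]
        apply pow_le_pow_right₀ hB1
        calc _ ≤ (Finset.range M).card := Finset.card_le_card (by intro x; simp)
          _ = M := by simp

/-- common values counted through fibres -/
theorem card_eq_fib {α β γ : Type*} [DecidableEq γ] (A : Finset α) (B : Finset β) (a : α → γ) (b : β → γ)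
    (T : Finset γ) (hT : ∀ x ∈ A, a x ∈ T) :
    ((A ×ˢ B).filter (fun z => a z.1 = b z.2)).card =
      ∑ m ∈ T, (A.filter (fun x => a x = m)).card * (B.filter (fun y => b y = m)).card := by
  rw [Finset.card_eq_sum_card_fiberwise (f := fun z => a z.1) (t := T)]
  · refine Finset.sum_congr rfl fun m _ => ?_
    rw [← Finset.card_product]
    congr 1
    ext z
    simp only [mem_filter, mem_product]
    grind
  · intro z hz
    simp only [coe_filter, mem_product, Set.mem_ofPred_eq] at hz
    exact hT _ hz.1.1

theorem cs_count {α β γ : Type*} [DecidableEq γ] (A : Finset α) (B : Finset β) (a : α → γ) (b : β → γ) :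
    ((A ×ˢ B).filter (fun z => a z.1 = b z.2)).card ^ 2 ≤
      ((A ×ˢ A).filter (fun z => a z.1 = a z.2)).card *
      ((B ×ˢ B).filter (fun z => b z.1 = b z.2)).card := by
  have hA : ∀ x ∈ A, a x ∈ A.image a ∪ B.image b := by grind
  have hB : ∀ x ∈ B, b x ∈ A.image a ∪ B.image b := by grind
  rw [card_eq_fib A B a b _ hA, card_eq_fib A A a a _ hA, card_eq_fib B B b b _ hB]
  simp only [← sq]
  exact Finset.sum_mul_sq_le_sq_mul_sq _ _ _

theorem split_count {α γ δ : Type*} [DecidableEq γ] [DecidableEq δ] (A : Finset α) (a : α → γ) (π : α → δ)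
    (Hs : Finset δ) (hπ : ∀ x ∈ A, π x ∈ Hs) :
    ((A ×ˢ A).filter (fun z => a z.1 = a z.2)).card ≤
      Hs.card * ((A ×ˢ A).filter (fun z => (a z.1, π z.1) = (a z.2, π z.2))).card := by
  have hA : ∀ x ∈ A, a x ∈ A.image a := by grind
  rw [card_eq_fib A A a a _ hA, card_eq_fib A A (fun x => (a x, π x)) (fun x => (a x, π x)) (A.image a ×ˢ Hs)
    (fun x hx => by simp only [mem_product]; exact ⟨hA x hx, hπ x hx⟩), Finset.sum_product, Finset.mul_sum]
  refine Finset.sum_le_sum fun m _ => ?_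
  have : (A.filter (fun x => a x = m)).card = ∑ h ∈ Hs, (A.filter (fun x => (a x, π x) = (m, h))).card := by
    rw [Finset.card_eq_sum_card_fiberwise (f := π) (t := Hs)]
    · refine Finset.sum_congr rfl fun h _ => ?_
      congr 1
      ext z
      simp only [mem_filter, Prod.mk.injEq]
      tauto
    · intro z hz
      simp only [coe_filter, Set.mem_ofPred_eq] at hz
      exact hπ _ hz.1
  rw [this, ← sq]
  simp only [← sq]
  exact sq_sum_le_card_mul_sum_sq

theorem fib_count {α β γ : Type*} [DecidableEq γ] (A : Finset α) (B : Finset β) (a : α → γ) (b : β → γ) (D : ℕ)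
    (h : ∀ y ∈ B, (A.filter (fun x => a x = b y)).card ≤ D) :
    ((A ×ˢ B).filter (fun z => a z.1 = b z.2)).card ≤ B.card * D := by
  classical
  rw [Finset.card_eq_sum_card_fiberwise (f := fun z => z.2) (t := B)]
  · rw [← smul_eq_mul]
    refine Finset.sum_le_card_nsmul _ _ _ fun y hy => le_trans ?_ (h y hy)
    refine Finset.card_le_card_of_injOn (fun z => z.1) ?_ ?_
    · intro z hz
      simp only [coe_filter, mem_filter, mem_product, Set.mem_ofPred_eq] at hz ⊢
      grind
    · intro z hz w hw hzw
      simp only [coe_filter, mem_filter, mem_product, Set.mem_ofPred_eq] at hz hw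
      ext <;> grind
  · intro z hz
    simp only [coe_filter, mem_product, Set.mem_ofPred_eq] at hz
    exact hz.1.2

/-- number of signed divisors -/
def Tau (d : ℤ) : ℕ := 2 * d.natAbs.divisors.card

def Dv (d : ℤ) : Finset ℤ := (d.natAbs.divisors.image (fun x : ℕ => (x : ℤ))) ∪
  (d.natAbs.divisors.image (fun x : ℕ => -(x : ℤ)))

theorem Dv_card (d : ℤ) : (Dv d).card ≤ Tau d := by
  unfold Dv Tau
  refine (Finset.card_union_le _ _).trans ?_
  have h1 := Finset.card_image_le (s := d.natAbs.divisors) (f := fun x : ℕ => (x : ℤ))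
  have h2 := Finset.card_image_le (s := d.natAbs.divisors) (f := fun x : ℕ => -(x : ℤ))
  omega

theorem mem_Dv {d u : ℤ} (hd : d ≠ 0) (h : u ∣ d) : u ∈ Dv d := by
  have h1 : u.natAbs ∈ d.natAbs.divisors := by
    simp [Nat.mem_divisors, hd, Int.natAbs_dvd_natAbs, h]
  unfold Dv
  rw [mem_union, mem_image, mem_image]
  rcases Int.natAbs_eq u with h2 | h2
  · exact Or.inl ⟨_, h1, h2.symm⟩
  · exact Or.inr ⟨_, h1, h2.symm⟩

def P2 (k : ℕ) : Prop := ∀ z u t : ℤ, 0 ≤ z → 0 < u → 0 < t →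
  0 < (z + t + u) ^ k - (z + t) ^ k - ((z + u) ^ k - z ^ k)
def P3 (k : ℕ) : Prop := ∀ z u v t : ℤ, 0 ≤ z → 0 < u → 0 < v → 0 < t →
  0 < ((z + t + u + v) ^ k - (z + t + u) ^ k - (z + t + v) ^ k + (z + t) ^ k) -
   ((z + u + v) ^ k - (z + u) ^ k - (z + v) ^ k + z ^ k)

theorem P2_2 : P2 2 := by intro z u t hz hu ht; ring_nf; positivity
theorem P2_5 : P2 5 := by intro z u t hz hu ht; ring_nf; positivity
theorem P2_6 : P2 6 := by intro z u t hz hu ht; ring_nf; positivity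
theorem P2_7 : P2 7 := by intro z u t hz hu ht; ring_nf; positivity
theorem P3_5 : P3 5 := by intro z u v t hz hu hv ht; ring_nf; positivity
theorem P3_6 : P3 6 := by intro z u v t hz hu hv ht; ring_nf; positivity
theorem P3_7 : P3 7 := by intro z u v t hz hu hv ht; ring_nf; positivity

/-- given differences, the base point is determined -/
theorem inj2 {k : ℕ} (hk : P2 k) (x y x' y' : ℤ) (hx : 0 ≤ x) (hy : 0 ≤ y) (hx' : 0 ≤ x') (hy' : 0 ≤ y')
    (h : x - y = x' - y') (hne : x - y ≠ 0) (he : x ^ k - y ^ k = x' ^ k - y' ^ k) : x = x' := by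
  have key : ∀ a b t : ℤ, 0 ≤ a → 0 ≤ b → a ≠ b → 0 < t → a ^ k - b ^ k ≠ (a + t) ^ k - (b + t) ^ k := by
    intro a b t ha hb hab ht h
    rcases lt_or_gt_of_ne hab with h1 | h1
    · have := hk a (b - a) t ha (by linarith) ht
      rw [show a + t + (b - a) = b + t by ring, show a + (b - a) = b by ring] at this
      linarith
    · have := hk b (a - b) t hb (by linarith) ht
      rw [show b + t + (a - b) = a + t by ring, show b + (a - b) = a by ring] at this
      linarith
  rcases lt_trichotomy x x' with h1 | h1 | h1
  · exfalso
    apply key x y (x' - x) hx hy (fun h => hne (by linarith)) (by linarith)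
    rw [show x + (x' - x) = x' by ring, show y + (x' - x) = y' by linarith]; exact he
  · exact h1
  · exfalso
    apply key x' y' (x - x') hx' hy' (fun h => hne (by linarith)) (by linarith)
    rw [show x' + (x - x') = x by ring, show y' + (x - x') = y by linarith]; exact he.symm

theorem inj4 {k : ℕ} (hk : P3 k) (z h l t : ℤ) (h1 : 0 ≤ z) (h2 : 0 ≤ z + h) (h3 : 0 ≤ z + l)
    (h4 : 0 ≤ z + h + l) (hh : h ≠ 0) (hl : l ≠ 0) (ht : 0 < t) :
    ((z + t + h + l) ^ k - (z + t + h) ^ k - (z + t + l) ^ k + (z + t) ^ k) ≠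
   ((z + h + l) ^ k - (z + h) ^ k - (z + l) ^ k + z ^ k) := by
  intro he
  rcases lt_or_gt_of_ne hh with ha | ha <;> rcases lt_or_gt_of_ne hl with hb | hb
  · have := hk (z + h + l) (-h) (-l) t h4 (by linarith) (by linarith) ht
    ring_nf at this he
    linarith
  · have := hk (z + h) (-h) (l) t h2 (by linarith) (by linarith) ht
    ring_nf at this he
    linarith
  · have := hk (z + l) (h) (-l) t h3 (by linarith) (by linarith) ht
    ring_nf at this he
    linarith
  · have := hk (z) (h) (l) t h1 (by linarith) (by linarith) ht
    ring_nf at this he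
    linarith

theorem fib2 {k : ℕ} (hk : P2 k) (S : Finset ℕ) (d : ℤ) (hd : d ≠ 0) :
    ((S ×ˢ S).filter (fun z => (z.1 : ℤ) ^ k - (z.2 : ℤ) ^ k = d)).card ≤ Tau d := by
  refine le_trans ?_ (Dv_card d)
  refine Finset.card_le_card_of_injOn (fun z => (z.1 : ℤ) - z.2) ?_ ?_
  · intro z hz
    simp only [coe_filter, mem_product, Set.mem_ofPred_eq] at hz
    rw [mem_coe]
    apply mem_Dv hd
    rw [← hz.2]
    exact sub_dvd_pow_sub_pow _ _ _
  · intro z hz w hw hzw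
    simp only [coe_filter, mem_product, Set.mem_ofPred_eq] at hz hw
    have hne : (z.1 : ℤ) - z.2 ≠ 0 := by
      intro h0
      apply hd
      rw [← hz.2, sub_eq_zero.1 h0, sub_self]
    have := inj2 hk z.1 z.2 w.1 w.2 (by positivity) (by positivity) (by positivity) (by positivity) hzw hne
      (hz.2.trans hw.2.symm)
    simp only at hzw
    ext <;> omega

theorem fib4 {k : ℕ} (hk : P3 k) (S : Finset ℕ) (d : ℤ) (hd : d ≠ 0) :
    (((S ×ˢ S) ×ˢ (S ×ˢ S)).filter (fun w => ((w.1.1 : ℤ) - w.1.2 = w.2.1 - w.2.2) ∧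
      ((w.1.1 : ℤ) ^ k - (w.1.2 : ℤ) ^ k) - ((w.2.1 : ℤ) ^ k - (w.2.2 : ℤ) ^ k) = d)).card ≤ Tau d ^ 2 := by
  have hc : (Dv d ×ˢ Dv d).card ≤ Tau d ^ 2 := by
    rw [card_product, sq]; exact Nat.mul_le_mul (Dv_card d) (Dv_card d)
  refine le_trans ?_ hc
  refine Finset.card_le_card_of_injOn (fun w => ((w.1.1 : ℤ) - w.1.2, (w.1.1 : ℤ) - w.2.1)) ?_ ?_
  · rintro ⟨⟨x, y⟩, ⟨x', y'⟩⟩ hz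
    simp only [coe_filter, mem_product, Set.mem_ofPred_eq] at hz
    obtain ⟨-, h1, h2⟩ := hz
    rw [mem_coe, mem_product]
    constructor
    · apply mem_Dv hd
      rw [← h2]
      apply dvd_sub (sub_dvd_pow_sub_pow _ _ _)
      simp only [h1]
      exact sub_dvd_pow_sub_pow _ _ _
    · apply mem_Dv hd
      have : ((x : ℤ) ^ k - (y : ℤ) ^ k) - ((x' : ℤ) ^ k - (y' : ℤ) ^ k)
        = ((x : ℤ) ^ k - (x' : ℤ) ^ k) - ((y : ℤ) ^ k - (y' : ℤ) ^ k) := by ring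
      rw [← h2, this]
      apply dvd_sub (sub_dvd_pow_sub_pow _ _ _)
      simp only [show (x : ℤ) - x' = y - y' by linarith]
      exact sub_dvd_pow_sub_pow _ _ _
  · rintro ⟨⟨x, y⟩, ⟨x', y'⟩⟩ hz ⟨⟨a, b⟩, ⟨a', b'⟩⟩ hw hzw
    simp only [coe_filter, mem_product, Set.mem_ofPred_eq, Prod.mk.injEq] at hz hw hzw
    obtain ⟨-, h1, h2⟩ := hz
    obtain ⟨-, h3, h4⟩ := hw
    obtain ⟨h5, h6⟩ := hzw
    have hh : (x : ℤ) - y ≠ 0 := by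
      intro h0
      apply hd
      rw [← h2, sub_eq_zero.1 h0, sub_eq_zero.1 (h1.symm.trans h0)]; ring
    have hl : (x : ℤ) - x' ≠ 0 := by
      intro h0
      apply hd
      rw [← h2, sub_eq_zero.1 h0, show (y : ℤ) = y' by linarith]; ring
    have key : ∀ p q r s p' q' r' s' : ℕ, (p : ℤ) - q = r - s → (p' : ℤ) - q' = r' - s' →
      (p : ℤ) - q = p' - q' → (p : ℤ) - r = p' - r' → (p : ℤ) - q ≠ 0 → (p : ℤ) - r ≠ 0 → s < s' →
      ((p : ℤ) ^ k - (q : ℤ) ^ k) - ((r : ℤ) ^ k - (s : ℤ) ^ k) ≠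
      ((p' : ℤ) ^ k - (q' : ℤ) ^ k) - ((r' : ℤ) ^ k - (s' : ℤ) ^ k) := by
      intro p q r s p' q' r' s' e1 e2 e3 e4 n1 n2 hlt he
      apply inj4 hk s (p - q) (p - r) (s' - s) (by omega) (by omega) (by omega) (by omega) n1 n2 (by omega)
      rw [show (s : ℤ) + (s' - s) + (p - q) + (p - r) = p' by linarith,
        show (s : ℤ) + (s' - s) + (p - q) = r' by linarith,
        show (s : ℤ) + (s' - s) + (p - r) = q' by linarith,
        show (s : ℤ) + (s' - s) = s' by linarith,
        show (s : ℤ) + (p - q) + (p - r) = p by linarith,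
        show (s : ℤ) + (p - q) = r by linarith,
        show (s : ℤ) + (p - r) = q by linarith]
      linarith
    have hy : y' = b' := by
      rcases lt_trichotomy y' b' with h | h | h
      · exact absurd (h2.trans h4.symm) (key _ _ _ _ _ _ _ _ h1 h3 h5 h6 hh hl h)
      · exact h
      · exact absurd (h4.trans h2.symm) (key _ _ _ _ _ _ _ _ h3 h1 h5.symm h6.symm (by omega) (by omega) h)
    subst hy
    have hx : (x : ℤ) = a := by linarith
    have hx' : (x' : ℤ) = a' := by linarith
    have hy : (y : ℤ) = b := by linarith
    simp only [Prod.mk.injEq]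
    exact ⟨⟨by exact_mod_cast hx, by exact_mod_cast hy⟩, by exact_mod_cast hx', trivial⟩

theorem nonvan {k : ℕ} (hk : P2 k) (x y x' y' : ℕ) (h1 : (x : ℤ) - y = x' - y') (h2 : x ≠ y)
    (h3 : (x, y) ≠ (x', y')) : ((x : ℤ) ^ k - (y : ℤ) ^ k) - ((x' : ℤ) ^ k - (y' : ℤ) ^ k) ≠ 0 := by
  intro h
  have := inj2 hk x y x' y' (by positivity) (by positivity) (by positivity) (by positivity) h1 (by omega)
    (by linarith)
  apply h3
  ext <;> simp only <;> omega

/-- number of coincidences of `b` on `B` -/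
def En {β : Type*} (B : Finset β) (b : β → ℤ) : ℕ := ((B ×ˢ B).filter (fun z => b z.1 = b z.2)).card

def pw (k : ℕ) (s : ℕ × ℕ) : ℤ := (s.1 : ℤ) ^ k - (s.2 : ℤ) ^ k
def df (s : ℕ × ℕ) : ℤ := (s.1 : ℤ) - s.2

def JJ (I : Finset (ℕ × ℕ)) : Finset ((ℕ × ℕ) × (ℕ × ℕ)) :=
  (I ×ˢ I).filter (fun j => df j.1 = df j.2 ∧ j.1 ≠ j.2)

theorem mem_JJ (I : Finset (ℕ × ℕ)) (j : (ℕ × ℕ) × (ℕ × ℕ)) :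
    j ∈ JJ I ↔ (j.1 ∈ I ∧ j.2 ∈ I) ∧ df j.1 = df j.2 ∧ j.1 ≠ j.2 := by
  rw [JJ, mem_filter, mem_product]

attribute [irreducible] pw df JJ

theorem midA (I B : Finset (ℕ × ℕ)) (φ b : ℕ × ℕ → ℤ) :
    (((I ×ˢ B) ×ˢ (I ×ˢ B)).filter (fun z => (φ z.1.1 + b z.1.2, df z.1.1) = (φ z.2.1 + b z.2.2, df z.2.1))).card
    ≤ I.card * En B b + ((JJ I ×ˢ (B ×ˢ B)).filter (fun z => φ z.1.1 - φ z.1.2 = b z.2.2 - b z.2.1)).card := by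
  rw [← Finset.card_filter_add_card_filter_not (fun z : ((ℕ × ℕ) × (ℕ × ℕ)) × ((ℕ × ℕ) × (ℕ × ℕ)) => z.1.1 = z.2.1)]
  apply Nat.add_le_add
  · unfold En
    rw [← Finset.card_product]
    refine Finset.card_le_card_of_injOn (fun z => (z.1.1, (z.1.2, z.2.2))) ?_ ?_
    · rintro ⟨⟨i, s⟩, ⟨i', s'⟩⟩ hz
      simp only [coe_filter, mem_filter, mem_product, Set.mem_ofPred_eq, mem_coe, Prod.mk.injEq] at hz ⊢
      obtain ⟨⟨⟨⟨h1, h2⟩, h3, h4⟩, h5, h6⟩, rfl⟩ := hz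
      exact ⟨h1, ⟨h2, h4⟩, by linarith⟩
    · rintro ⟨⟨i, s⟩, ⟨i', s'⟩⟩ hz ⟨⟨j, t⟩, ⟨j', t'⟩⟩ hw h
      simp only [coe_filter, mem_filter, Set.mem_ofPred_eq, Prod.mk.injEq] at hz hw h ⊢
      grind
  · refine Finset.card_le_card_of_injOn (fun z => ((z.1.1, z.2.1), (z.1.2, z.2.2))) ?_ ?_
    · rintro ⟨⟨i, s⟩, ⟨i', s'⟩⟩ hz
      simp only [mem_JJ, coe_filter, mem_filter, mem_product, Set.mem_ofPred_eq, Prod.mk.injEq] at hz ⊢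
      obtain ⟨⟨⟨⟨h1, h2⟩, h3, h4⟩, h5, h6⟩, h7⟩ := hz
      exact ⟨⟨⟨⟨h1, h3⟩, h6, h7⟩, h2, h4⟩, by linarith⟩
    · rintro ⟨⟨i, s⟩, ⟨i', s'⟩⟩ hz ⟨⟨j, t⟩, ⟨j', t'⟩⟩ hw h
      simp only [Prod.mk.injEq] at h ⊢
      tauto

/-- fibres of second differences -/
theorem fibJ {k : ℕ} (hk2 : P2 k) (hk3 : P3 k) (S : Finset ℕ) (I : Finset (ℕ × ℕ)) (hI : I ⊆ S ×ˢ S)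
    (hne : ∀ i ∈ I, i.1 ≠ i.2) (n L : ℕ) (hL : ∀ d : ℤ, d ≠ 0 → d.natAbs ≤ 4 * n → Tau d ^ 2 ≤ L)
    (d : ℤ) (hd : d.natAbs ≤ 4 * n) :
    ((JJ I).filter (fun j : (ℕ × ℕ) × (ℕ × ℕ) => pw k j.1 - pw k j.2 = d)).card ≤ L := by
  by_cases h0 : d = 0
  · rw [Finset.card_eq_zero.2]; · omega
    rw [Finset.filter_eq_empty_iff]
    rintro ⟨⟨x, y⟩, ⟨x', y'⟩⟩ hj
    simp only [mem_JJ, df] at hj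
    rw [h0]
    unfold pw
    exact nonvan hk2 x y x' y' hj.2.1 (hne _ hj.1.1) hj.2.2
  · refine le_trans ?_ (hL d h0 hd)
    refine le_trans (Finset.card_le_card ?_) (fib4 hk3 S d h0)
    intro j hj
    simp only [mem_JJ, mem_filter, mem_product, df, pw] at hj ⊢
    have h1 := hI hj.1.1.1
    have h2 := hI hj.1.1.2
    rw [mem_product] at h1 h2
    exact ⟨⟨h1, h2⟩, hj.1.2.1, hj.2⟩

theorem fib2pw {k : ℕ} (hk : P2 k) (S : Finset ℕ) (d : ℤ) (hd : d ≠ 0) :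
    ((S ×ˢ S).filter (fun z => pw k z = d)).card ≤ Tau d := by
  unfold pw
  exact fib2 hk S d hd

theorem pw_le {k n : ℕ} (G : Finset ℕ) (hG : ∀ r ∈ G, r ^ k ≤ n) (s : ℕ × ℕ) (hs : s ∈ G ×ˢ G) :
    (pw k s).natAbs ≤ n := by
  rw [mem_product] at hs
  have h1 := hG _ hs.1
  have h2 := hG _ hs.2
  unfold pw
  zify at h1 h2
  have h3 : (0 : ℤ) ≤ (s.1 : ℤ) ^ k := by positivity
  have h4 : (0 : ℤ) ≤ (s.2 : ℤ) ^ k := by positivity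
  omega

theorem Tau_pos (d : ℤ) (hd : d ≠ 0) : 1 ≤ Tau d := by
  unfold Tau
  have : 0 < d.natAbs.divisors.card := Finset.card_pos.2 ⟨1, by simp [hd]⟩
  omega

theorem Tau_le_L {n L : ℕ} (hL : ∀ d : ℤ, d ≠ 0 → d.natAbs ≤ 4 * n → Tau d ^ 2 ≤ L)
    (d : ℤ) (h0 : d ≠ 0) (hd : d.natAbs ≤ 4 * n) : Tau d ≤ L :=
  (Nat.le_self_pow (by norm_num) _).trans (hL d h0 hd)

theorem diagc_le (G : Finset ℕ) : ((G ×ˢ G).filter (fun s => s.1 = s.2)).card ≤ G.card := by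
  refine Finset.card_le_card_of_injOn (fun s => s.1) ?_ ?_
  · intro s hs
    simp only [coe_filter, mem_product, Set.mem_ofPred_eq, mem_coe] at hs ⊢
    exact hs.1.1
  · intro s hs t ht h
    simp only [coe_filter, mem_product, Set.mem_ofPred_eq] at hs ht h
    ext <;> grind

theorem R0_le (G : Finset ℕ) (n L : ℕ) (hL1 : 1 ≤ L)
    (hL : ∀ d : ℤ, d ≠ 0 → d.natAbs ≤ 4 * n → Tau d ^ 2 ≤ L)
    (hG : ∀ r ∈ G, r ^ 5 ≤ n) : En (G ×ˢ G) (pw 5) ≤ 2 * L * G.card ^ 2 := by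
  have hz : ∀ s : ℕ × ℕ, pw 5 s = 0 → s.1 = s.2 := by
    intro s hs
    unfold pw at hs
    have h1 : (s.1 : ℤ) ^ 5 = (s.2 : ℤ) ^ 5 := by linarith
    have h2 : s.1 ^ 5 = s.2 ^ 5 := by exact_mod_cast h1
    exact Nat.pow_left_injective (n := 5) (by norm_num) h2
  unfold En
  rw [← Finset.card_filter_add_card_filter_not (fun z : (ℕ × ℕ) × (ℕ × ℕ) => pw 5 z.2 = 0)]
  have h1 : ((((G ×ˢ G) ×ˢ (G ×ˢ G)).filter (fun z => pw 5 z.1 = pw 5 z.2)).filter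
      (fun z => pw 5 z.2 = 0)).card ≤ G.card * G.card := by
    refine le_trans (Finset.card_le_card (t := ((G ×ˢ G).filter (fun s => s.1 = s.2)) ×ˢ
      ((G ×ˢ G).filter (fun s => s.1 = s.2))) ?_) ?_
    · intro z h
      simp only [mem_filter, mem_product] at h ⊢
      exact ⟨⟨h.1.1.1, hz _ (h.1.2.trans h.2)⟩, h.1.1.2, hz _ h.2⟩
    · rw [card_product]
      exact Nat.mul_le_mul (diagc_le G) (diagc_le G)
  have h2 : ((((G ×ˢ G) ×ˢ (G ×ˢ G)).filter (fun z => pw 5 z.1 = pw 5 z.2)).filter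
      (fun z => ¬ pw 5 z.2 = 0)).card ≤ (G.card * G.card) * L := by
    refine le_trans (Finset.card_le_card (t := ((G ×ˢ G) ×ˢ ((G ×ˢ G).filter (fun s => ¬ pw 5 s = 0))).filter
      (fun z => pw 5 z.1 = pw 5 z.2)) ?_) ?_
    · intro z h
      simp only [mem_filter, mem_product] at h ⊢
      tauto
    · refine le_trans (fib_count _ _ _ _ L ?_) ?_
      · intro y hy
        rw [mem_filter] at hy
        have hyn := pw_le G hG y hy.1
        exact (fib2pw P2_5 G _ hy.2).trans (Tau_le_L hL _ hy.2 (by omega))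
      · apply Nat.mul_le_mul_right
        rw [← card_product]
        exact Finset.card_filter_le _ _
  have h3 : G.card * G.card ≤ G.card * G.card * L := Nat.le_mul_of_pos_right _ hL1
  calc _ ≤ G.card * G.card * L + G.card * G.card * L := by omega
    _ = _ := by ring

/-- Hua's eighth moment. -/
theorem hua8 (G : Finset ℕ) (n L X : ℕ) (hL1 : 1 ≤ L) (hX : 1 ≤ X)
    (hL : ∀ d : ℤ, d ≠ 0 → d.natAbs ≤ 4 * n → Tau d ^ 2 ≤ L)
    (hG : ∀ r ∈ G, r ^ 5 ≤ n) (hGX : ∀ r ∈ G, r ≤ X) (hGc : G.card ≤ X) :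
    En ((G ×ˢ G) ×ˢ (G ×ˢ G)) (fun w => pw 5 w.1 + pw 5 w.2) ≤ 15 * L * X ^ 5 := by
  set B := G ×ˢ G with hB
  have hBc : B.card ≤ X ^ 2 := by
    rw [hB, card_product, sq]; exact Nat.mul_le_mul hGc hGc
  have hR : En B (pw 5) ≤ 2 * L * X ^ 2 :=
    (R0_le G n L hL1 hL hG).trans (Nat.mul_le_mul_left _ (Nat.pow_le_pow_left hGc 2))
  have hs := split_count (B ×ˢ B) (fun w => pw 5 w.1 + pw 5 w.2) (fun w => df w.1)
    (Finset.Icc (-(X : ℤ)) X) (by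
      rintro ⟨⟨x, y⟩, w⟩ h
      simp only [hB, mem_product] at h
      have h1 := hGX _ h.1.1
      have h2 := hGX _ h.1.2
      simp only [df, mem_Icc]
      omega)
  unfold En
  refine hs.trans ?_
  have hcard : (Finset.Icc (-(X : ℤ)) X).card ≤ 3 * X := by
    rw [Int.card_Icc]; omega
  set I := B.filter (fun i => i.1 ≠ i.2) with hI
  set B0 := B.filter (fun i => i.1 = i.2) with hB0
  have hmB0 : ∀ i, i ∈ B0 ↔ i ∈ B ∧ i.1 = i.2 := fun i => by rw [hB0, mem_filter]
  have hmI : ∀ i, i ∈ I ↔ i ∈ B ∧ i.1 ≠ i.2 := fun i => by rw [hI, mem_filter]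
  have hIc : I.card ≤ X ^ 2 := (Finset.card_filter_le _ _).trans hBc
  have hB0c : B0.card ≤ X := (diagc_le G).trans hGc
  have hM : (((B ×ˢ B) ×ˢ (B ×ˢ B)).filter (fun z => (pw 5 z.1.1 + pw 5 z.1.2, df z.1.1) =
      (pw 5 z.2.1 + pw 5 z.2.2, df z.2.1))).card ≤ 5 * L * X ^ 4 := by
    rw [← Finset.card_filter_add_card_filter_not
      (fun z : ((ℕ × ℕ) × (ℕ × ℕ)) × ((ℕ × ℕ) × (ℕ × ℕ)) => z.1.1.1 = z.1.1.2)]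
    have h1 : ((((B ×ˢ B) ×ˢ (B ×ˢ B)).filter (fun z => (pw 5 z.1.1 + pw 5 z.1.2, df z.1.1) =
      (pw 5 z.2.1 + pw 5 z.2.2, df z.2.1))).filter (fun z => z.1.1.1 = z.1.1.2)).card ≤
        (B0.card * B0.card) * En B (pw 5) := by
      unfold En
      rw [← card_product, ← card_product]
      refine Finset.card_le_card_of_injOn (fun z => ((z.1.1, z.2.1), (z.1.2, z.2.2))) ?_ ?_
      · rintro ⟨⟨i, s⟩, ⟨i', s'⟩⟩ hz
        simp only [mem_coe, mem_filter, mem_product (s := B ×ˢ B), mem_product (s := B), Prod.mk.injEq] at hz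
        simp only [mem_coe, mem_product (s := B0 ×ˢ B0), mem_product (s := B0), mem_filter, mem_product (s := B), hmB0]
        obtain ⟨⟨⟨⟨h1, h2⟩, h3, h4⟩, h5, h6⟩, h7⟩ := hz
        have h8 : i'.1 = i'.2 := by unfold df at h6; omega
        refine ⟨⟨⟨h1, h7⟩, h3, h8⟩, ⟨h2, h4⟩, ?_⟩
        have e1 : pw 5 i = 0 := by unfold pw; rw [h7]; ring
        have e2 : pw 5 i' = 0 := by unfold pw; rw [h8]; ring
        rw [e1, e2] at h5
        linarith
      · rintro ⟨⟨i, s⟩, ⟨i', s'⟩⟩ hz ⟨⟨j, t⟩, ⟨j', t'⟩⟩ hw h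
        simp only [Prod.mk.injEq] at h ⊢
        tauto
    have h2 : ((((B ×ˢ B) ×ˢ (B ×ˢ B)).filter (fun z => (pw 5 z.1.1 + pw 5 z.1.2, df z.1.1) =
      (pw 5 z.2.1 + pw 5 z.2.2, df z.2.1))).filter (fun z => ¬ z.1.1.1 = z.1.1.2)).card ≤
        I.card * En B (pw 5) + (B ×ˢ B).card * L := by
      refine le_trans (Finset.card_le_card ?_) ((midA I B (pw 5) (pw 5)).trans
        (Nat.add_le_add_left (fib_count _ _ (fun j : (ℕ × ℕ) × (ℕ × ℕ) => pw 5 j.1 - pw 5 j.2) (fun t : (ℕ × ℕ) × (ℕ × ℕ) => pw 5 t.2 - pw 5 t.1) L ?_) _))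
      · rintro ⟨⟨i, s⟩, ⟨i', s'⟩⟩ hz
        simp only [mem_filter, mem_product (s := B ×ˢ B), mem_product (s := B), Prod.mk.injEq] at hz
        simp only [mem_filter, mem_product (s := I ×ˢ B), mem_product (s := I), hmI, Prod.mk.injEq]
        obtain ⟨⟨⟨⟨h1, h2⟩, h3, h4⟩, h5, h6⟩, h7⟩ := hz
        refine ⟨⟨⟨⟨h1, h7⟩, h2⟩, ⟨h3, ?_⟩, h4⟩, h5, h6⟩
        unfold df at h6; omega
      · intro t ht
        rw [mem_product] at ht
        have e1 := pw_le G hG _ ht.1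
        have e2 := pw_le G hG _ ht.2
        exact fibJ P2_5 P3_5 G I (Finset.filter_subset _ _) (fun i hi => (mem_filter.1 hi).2) n L hL _ (by omega)
    calc _ ≤ (B0.card * B0.card) * En B (pw 5) + (I.card * En B (pw 5) + (B ×ˢ B).card * L) :=
          Nat.add_le_add h1 h2
      _ ≤ (X * X) * (2 * L * X ^ 2) + (X ^ 2 * (2 * L * X ^ 2) + (X ^ 2 * X ^ 2) * L) := by
          rw [card_product]; gcongr
      _ = _ := by ring
  calc _ ≤ (3 * X) * (5 * L * X ^ 4) := Nat.mul_le_mul hcard hM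
    _ = _ := by ring

/-- The off-diagonal count. -/
theorem koff {k : ℕ} (hk2 : P2 k) (hk3 : P3 k) (G Q : Finset ℕ) (n L X Y H : ℕ) (hL1 : 1 ≤ L) (hX : 1 ≤ X)
    (hH : 1 ≤ H)
    (hL : ∀ d : ℤ, d ≠ 0 → d.natAbs ≤ 4 * n → Tau d ^ 2 ≤ L)
    (hG : ∀ r ∈ G, r ^ 5 ≤ n) (hGX : ∀ r ∈ G, r ≤ X) (hGc : G.card ≤ X)
    (hQ : ∀ q ∈ Q, q ^ k ≤ n) (hQc : Q.card ≤ Y)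
    (I : Finset (ℕ × ℕ)) (hI : I = (Q ×ˢ Q).filter (fun i => i.1 ≠ i.2 ∧ (df i).natAbs ≤ H)) :
    ∃ M2 : ℕ, M2 ^ 2 ≤ 45 * H * Y ^ 2 * X ^ 5 * L ^ 2 ∧
    (((I ×ˢ (G ×ˢ G)) ×ˢ (G ×ˢ G)).filter (fun z => pw k z.1.1 + pw 5 z.1.2 = pw 5 z.2)).card ^ 2 ≤
      (3 * H) * (3 * H * Y * (2 * L * X ^ 2) + M2) * (2 * L * X ^ 2) := by
  set B := G ×ˢ G with hB
  have hR : En B (pw 5) ≤ 2 * L * X ^ 2 :=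
    (R0_le G n L hL1 hL hG).trans (Nat.mul_le_mul_left _ (Nat.pow_le_pow_left hGc 2))
  have hHs : (Finset.Icc (-(H : ℤ)) H).card ≤ 3 * H := by rw [Int.card_Icc]; omega
  have hIH : ∀ i ∈ I, df i ∈ Finset.Icc (-(H : ℤ)) H := by
    intro i hi
    rw [hI, mem_filter] at hi
    rw [mem_Icc]; omega
  have hIc : I.card ≤ 3 * H * Y := by
    calc I.card ≤ (Q ×ˢ Finset.Icc (-(H : ℤ)) H).card := by
          refine Finset.card_le_card_of_injOn (fun i => (i.1, df i)) ?_ ?_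
          · intro i hi
            rw [mem_coe, mem_product]
            refine ⟨?_, hIH i hi⟩
            rw [hI, mem_coe, mem_filter, mem_product] at hi
            exact hi.1.1
          · intro i _ j _ h
            simp only [Prod.mk.injEq, df] at h
            ext <;> omega
      _ ≤ Y * (3 * H) := by rw [card_product]; exact Nat.mul_le_mul hQc hHs
      _ = _ := by ring
  have hJc : (JJ I).card ≤ 3 * H * Y ^ 2 := by
    calc (JJ I).card ≤ (I ×ˢ Q).card := by
          refine Finset.card_le_card_of_injOn (fun j => (j.1, j.2.1)) ?_ ?_
          · intro j hj
            rw [mem_coe, mem_JJ] at hj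
            rw [mem_coe, mem_product]
            refine ⟨hj.1.1, ?_⟩
            have := hj.1.2
            rw [hI, mem_filter, mem_product] at this
            exact this.1.1
          · rintro ⟨⟨a, b⟩, ⟨c, d⟩⟩ hi ⟨⟨a', b'⟩, ⟨c', d'⟩⟩ hj h
            rw [mem_coe, mem_JJ] at hi hj
            replace hi := hi.2.1
            replace hj := hj.2.1
            simp only [Prod.mk.injEq, df] at h hi hj ⊢
            omega
      _ ≤ (3 * H * Y) * Y := by rw [card_product]; exact Nat.mul_le_mul hIc hQc
      _ = _ := by ring
  have hIQ : I ⊆ Q ×ˢ Q := by rw [hI]; exact Finset.filter_subset _ _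
  have hIne : ∀ i ∈ I, i.1 ≠ i.2 := by
    intro i hi; rw [hI, mem_filter] at hi; exact hi.2.1
  refine ⟨((JJ I ×ˢ (B ×ˢ B)).filter (fun z => pw k z.1.1 - pw k z.1.2 = pw 5 z.2.2 - pw 5 z.2.1)).card, ?_, ?_⟩
  · refine (cs_count (JJ I) (B ×ˢ B) (fun j : (ℕ × ℕ) × (ℕ × ℕ) => pw k j.1 - pw k j.2) (fun t : (ℕ × ℕ) × (ℕ × ℕ) => pw 5 t.2 - pw 5 t.1)).trans ?_
    have h1 : ((JJ I ×ˢ JJ I).filter (fun z => pw k z.1.1 - pw k z.1.2 = pw k z.2.1 - pw k z.2.2)).card ≤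
        (JJ I).card * L := by
      refine fib_count _ _ (fun j : (ℕ × ℕ) × (ℕ × ℕ) => pw k j.1 - pw k j.2) (fun j : (ℕ × ℕ) × (ℕ × ℕ) => pw k j.1 - pw k j.2) L ?_
      intro j hj
      rw [mem_JJ] at hj
      have e1 := pw_le Q hQ _ (hIQ hj.1.1)
      have e2 := pw_le Q hQ _ (hIQ hj.1.2)
      exact fibJ hk2 hk3 Q I hIQ hIne n L hL _ (by omega)
    have h2 : (((B ×ˢ B) ×ˢ (B ×ˢ B)).filter (fun z => pw 5 z.1.2 - pw 5 z.1.1 = pw 5 z.2.2 - pw 5 z.2.1)).card ≤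
        15 * L * X ^ 5 := by
      refine le_trans ?_ (hua8 G n L X hL1 hX hL hG hGX hGc)
      unfold En
      rw [← hB]
      refine Finset.card_le_card_of_injOn (fun z => ((z.1.2, z.2.1), (z.2.2, z.1.1))) ?_ ?_
      · rintro ⟨⟨i, s⟩, ⟨i', s'⟩⟩ hz
        simp only [mem_coe, mem_filter, mem_product (s := B ×ˢ B), mem_product (s := B)] at hz ⊢
        refine ⟨⟨⟨hz.1.1.2, hz.1.2.1⟩, hz.1.2.2, hz.1.1.1⟩, by linarith [hz.2]⟩
      · rintro ⟨⟨i, s⟩, ⟨i', s'⟩⟩ hz ⟨⟨j, t⟩, ⟨j', t'⟩⟩ hw h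
        simp only [Prod.mk.injEq] at h ⊢
        tauto
    calc _ ≤ ((3 * H * Y ^ 2) * L) * (15 * L * X ^ 5) :=
          Nat.mul_le_mul (h1.trans (Nat.mul_le_mul_right _ hJc)) h2
      _ = _ := by ring
  · refine (cs_count (I ×ˢ B) B (fun z => pw k z.1 + pw 5 z.2) (pw 5)).trans ?_
    refine Nat.mul_le_mul ?_ hR
    refine (split_count (I ×ˢ B) (fun z => pw k z.1 + pw 5 z.2) (fun z => df z.1) (Finset.Icc (-(H : ℤ)) H)
      (fun z hz => hIH _ (mem_product.1 hz).1)).trans ?_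
    refine Nat.mul_le_mul hHs ((midA I B (pw k) (pw 5)).trans ?_)
    exact Nat.add_le_add_right (Nat.mul_le_mul hIc hR) _

theorem pw_diag (k : ℕ) (s : ℕ × ℕ) (h : s.1 = s.2) : pw k s = 0 := by
  unfold pw; rw [h]; ring

/-- The total count. -/
theorem total {k : ℕ} (hk2 : P2 k) (hk3 : P3 k) (A2 G Q : Finset ℕ) (n L X Y H : ℕ) (hL1 : 1 ≤ L) (hX : 1 ≤ X)
    (hH : 1 ≤ H)
    (hL : ∀ d : ℤ, d ≠ 0 → d.natAbs ≤ 4 * n → Tau d ^ 2 ≤ L)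
    (hXn : X ^ 5 ≤ n) (hGX : ∀ r ∈ G, r ≤ X) (hGc : G.card ≤ X)
    (hQ : ∀ q ∈ Q, q ^ k ≤ n) (hQc : Q.card ≤ Y)
    (hsep : ∀ q ∈ Q ×ˢ Q, (pw k q).natAbs ≤ 2 * X ^ 5 → (df q).natAbs ≤ H) :
    ∃ M2 K : ℕ, M2 ^ 2 ≤ 45 * H * Y ^ 2 * X ^ 5 * L ^ 2 ∧
      K ^ 2 ≤ (3 * H) * (3 * H * Y * (2 * L * X ^ 2) + M2) * (2 * L * X ^ 2) ∧
      ((((A2 ×ˢ Q) ×ˢ (G ×ˢ G)) ×ˢ ((A2 ×ˢ Q) ×ˢ (G ×ˢ G))).filter (fun z =>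
        (z.1.1.1 : ℤ) ^ 2 + (z.1.1.2 : ℤ) ^ k + ((z.1.2.1 : ℤ) ^ 5 + (z.1.2.2 : ℤ) ^ 5) =
        (z.2.1.1 : ℤ) ^ 2 + (z.2.1.2 : ℤ) ^ k + ((z.2.2.1 : ℤ) ^ 5 + (z.2.2.2 : ℤ) ^ 5))).card ≤
      A2.card * (Y * (2 * L * X ^ 2) + K) + Y ^ 2 * X ^ 4 * L := by
  have hG : ∀ r ∈ G, r ^ 5 ≤ n := fun r hr => (Nat.pow_le_pow_left (hGX r hr) 5).trans hXn
  have hG5 : ∀ r ∈ G, r ^ 5 ≤ X ^ 5 := fun r hr => (Nat.pow_le_pow_left (hGX r hr) 5)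
  obtain ⟨M2, hM2, hK⟩ := koff hk2 hk3 G Q n L X Y H hL1 hX hH hL hG hGX hGc hQ hQc _ rfl
  refine ⟨M2, _, hM2, hK, ?_⟩
  set I := (Q ×ˢ Q).filter (fun i => i.1 ≠ i.2 ∧ (df i).natAbs ≤ H) with hI
  set B := G ×ˢ G with hB
  set KS := (((Q ×ˢ Q) ×ˢ B) ×ˢ B).filter (fun z => pw k z.1.1 + pw 5 z.1.2 = pw 5 z.2) with hKS
  have hR : En B (pw 5) ≤ 2 * L * X ^ 2 :=
    (R0_le G n L hL1 hL hG).trans (Nat.mul_le_mul_left _ (Nat.pow_le_pow_left hGc 2))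
  have hKSc : KS.card ≤ Y * (2 * L * X ^ 2) +
      (((I ×ˢ B) ×ˢ B).filter (fun z => pw k z.1.1 + pw 5 z.1.2 = pw 5 z.2)).card := by
    rw [hKS, ← Finset.card_filter_add_card_filter_not
      (fun z : ((ℕ × ℕ) × (ℕ × ℕ)) × (ℕ × ℕ) => z.1.1.1 = z.1.1.2)]
    apply Nat.add_le_add
    · calc _ ≤ (Q ×ˢ ((B ×ˢ B).filter (fun z => pw 5 z.1 = pw 5 z.2))).card := by
            refine Finset.card_le_card_of_injOn (fun z => (z.1.1.1, (z.1.2, z.2))) ?_ ?_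
            · rintro ⟨⟨⟨q, q'⟩, s⟩, s'⟩ hz
              simp only [mem_coe, mem_filter, mem_product (s := (Q ×ˢ Q) ×ˢ B), mem_product (s := Q ×ˢ Q),
                mem_product (s := Q), mem_product (s := B)] at hz ⊢
              obtain ⟨⟨⟨⟨⟨h1, h2⟩, h3⟩, h4⟩, h5⟩, h6⟩ := hz
              rw [pw_diag k (q, q') h6] at h5
              exact ⟨h1, ⟨h3, h4⟩, by linarith⟩
            · rintro ⟨⟨⟨q, q'⟩, s⟩, s'⟩ hz ⟨⟨⟨p, p'⟩, t⟩, t'⟩ hw h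
              simp only [mem_coe, mem_filter] at hz hw
              have e1 := hz.2
              have e2 := hw.2
              simp only [Prod.mk.injEq] at h ⊢
              refine ⟨⟨⟨h.1, ?_⟩, h.2.1⟩, h.2.2⟩
              omega
        _ ≤ _ := by
            rw [card_product]; exact Nat.mul_le_mul hQc hR
    · apply Finset.card_le_card
      rintro ⟨⟨⟨q, q'⟩, s⟩, s'⟩ hz
      have hmI : ∀ i, i ∈ I ↔ i ∈ Q ×ˢ Q ∧ i.1 ≠ i.2 ∧ (df i).natAbs ≤ H := fun i => by rw [hI, mem_filter]
      simp only [mem_filter, mem_product (s := (Q ×ˢ Q) ×ˢ B), mem_product (s := Q ×ˢ Q),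
        mem_product (s := I), mem_product (s := I ×ˢ B), hmI] at hz ⊢
      obtain ⟨⟨⟨⟨h1, h3⟩, h4⟩, h5⟩, h6⟩ := hz
      refine ⟨⟨⟨⟨h1, h6, hsep _ h1 ?_⟩, h3⟩, h4⟩, h5⟩
      have e1 := pw_le G hG5 s h3
      have e2 := pw_le G hG5 s' h4
      omega
  rw [← Finset.card_filter_add_card_filter_not
      (fun z : ((ℕ × ℕ) × (ℕ × ℕ)) × ((ℕ × ℕ) × (ℕ × ℕ)) => z.1.1.1 = z.2.1.1)]
  apply Nat.add_le_add
  · refine le_trans ?_ (Nat.mul_le_mul_left A2.card hKSc)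
    rw [← card_product]
    refine Finset.card_le_card_of_injOn (fun z => (z.1.1.1, (((z.1.1.2, z.2.1.2), (z.1.2.1, z.2.2.1)),
      (z.2.2.2, z.1.2.2)))) ?_ ?_
    · rintro ⟨⟨⟨p, q⟩, ⟨r, s⟩⟩, ⟨⟨p', q'⟩, ⟨r', s'⟩⟩⟩ hz
      simp only [mem_coe, mem_filter, mem_product, hKS, hB] at hz ⊢
      obtain ⟨⟨⟨⟨⟨h1, h2⟩, h3, h4⟩, ⟨h5, h6⟩, h7, h8⟩, h9⟩, h10⟩ := hz
      refine ⟨h1, ⟨⟨⟨h2, h6⟩, h3, h7⟩, h8, h4⟩, ?_⟩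
      unfold pw
      rw [h10] at h9
      simp only
      linarith
    · rintro ⟨⟨⟨p, q⟩, ⟨r, s⟩⟩, ⟨⟨p', q'⟩, ⟨r', s'⟩⟩⟩ hz ⟨⟨⟨a, b⟩, ⟨c, d⟩⟩, ⟨⟨a', b'⟩, ⟨c', d'⟩⟩⟩ hw h
      simp only [mem_coe, mem_filter] at hz hw
      have e1 := hz.2
      have e2 := hw.2
      simp only [Prod.mk.injEq] at h ⊢
      refine ⟨⟨⟨h.1, h.2.1.1.1⟩, h.2.1.2.1, h.2.2.2⟩, ⟨?_, h.2.1.1.2⟩, h.2.1.2.2, h.2.2.1⟩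
      omega
  · have h1 : ((((A2 ×ˢ A2).filter (fun i => i.1 ≠ i.2)) ×ˢ ((Q ×ˢ Q) ×ˢ (B ×ˢ B))).filter
        (fun z => pw 2 z.1 = -(pw k z.2.1 + pw 5 z.2.2.1 + pw 5 z.2.2.2))).card ≤
        ((Q ×ˢ Q) ×ˢ (B ×ˢ B)).card * L := by
      refine fib_count _ _ (pw 2) (fun z : (ℕ × ℕ) × ((ℕ × ℕ) × (ℕ × ℕ)) =>
        -(pw k z.1 + pw 5 z.2.1 + pw 5 z.2.2)) L ?_
      rintro ⟨q, s, t⟩ hz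
      simp only [mem_product (s := Q ×ˢ Q), mem_product (s := B)] at hz
      have e1 := pw_le Q hQ q hz.1
      have e2 := pw_le G hG s hz.2.1
      have e3 := pw_le G hG t hz.2.2
      simp only
      generalize hd : -(pw k q + pw 5 s + pw 5 t) = d
      by_cases h0 : d = 0
      · rw [Finset.card_eq_zero.2]; · omega
        rw [Finset.filter_eq_empty_iff]
        rintro ⟨x, y⟩ hxy
        rw [mem_filter] at hxy
        rw [h0]
        unfold pw
        intro h
        apply hxy.2
        have h1 : (x : ℤ) ^ 2 = (y : ℤ) ^ 2 := by simp only at h; linarith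
        have h2 : x ^ 2 = y ^ 2 := by exact_mod_cast h1
        exact Nat.pow_left_injective (n := 2) (by norm_num) h2
      · refine le_trans (Finset.card_le_card ?_) ((fib2pw P2_2 A2 d h0).trans (Tau_le_L hL d h0 (by omega)))
        intro z hz
        rw [mem_filter, mem_filter] at hz
        rw [mem_filter]
        exact ⟨hz.1.1, hz.2⟩
    have h2 : ((Q ×ˢ Q) ×ˢ (B ×ˢ B)).card * L ≤ Y ^ 2 * X ^ 4 * L := by
      apply Nat.mul_le_mul_right
      rw [card_product, card_product, card_product, hB, card_product]
      calc _ ≤ (Y * Y) * ((X * X) * (X * X)) := by gcongr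
        _ = _ := by ring
    refine le_trans ?_ (h1.trans h2)
    refine Finset.card_le_card_of_injOn (fun z => ((z.1.1.1, z.2.1.1), ((z.1.1.2, z.2.1.2),
      ((z.1.2.1, z.2.2.1), (z.1.2.2, z.2.2.2))))) ?_ ?_
    · rintro ⟨⟨⟨p, q⟩, ⟨r, s⟩⟩, ⟨⟨p', q'⟩, ⟨r', s'⟩⟩⟩ hz
      simp only [mem_coe, mem_filter, mem_product, hB] at hz ⊢
      obtain ⟨⟨⟨⟨⟨h1, h2⟩, h3, h4⟩, ⟨h5, h6⟩, h7, h8⟩, h9⟩, h10⟩ := hz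
      refine ⟨⟨⟨⟨h1, h5⟩, h10⟩, ⟨h2, h6⟩, ⟨h3, h7⟩, h4, h8⟩, ?_⟩
      unfold pw
      simp only
      linarith
    · rintro ⟨⟨⟨p, q⟩, ⟨r, s⟩⟩, ⟨⟨p', q'⟩, ⟨r', s'⟩⟩⟩ hz ⟨⟨⟨a, b⟩, ⟨c, d⟩⟩, ⟨⟨a', b'⟩, ⟨c', d'⟩⟩⟩ hw h
      simp only [Prod.mk.injEq] at h ⊢
      tauto

/-- numerical consequence -/
theorem total_num (A X Y H L T M2 K Ar Xr Yr Hr Lr : ℝ) (hA : 0 ≤ A) (hX : 0 ≤ X) (hY : 0 ≤ Y) (hH : 0 ≤ H) (hL : 0 ≤ L)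
    (hM : 0 ≤ M2) (hK : 0 ≤ K)
    (hAr : A ≤ Ar) (hXr : X ≤ Xr) (hYr : Y ≤ Yr) (hHr : H ≤ Hr) (hLr : L ≤ Lr)
    (c1 : Hr ^ 2 ≤ 2 ^ 21 * Yr) (c2 : Hr ^ 3 * Xr ≤ 2 ^ 21 * Yr ^ 2) (c3 : Yr * Xr ^ 2 ≤ Ar)
    (h1 : M2 ^ 2 ≤ 45 * H * Y ^ 2 * X ^ 5 * L ^ 2)
    (h2 : K ^ 2 ≤ (3 * H) * (3 * H * Y * (2 * L * X ^ 2) + M2) * (2 * L * X ^ 2))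
    (h3 : T ≤ A * (Y * (2 * L * X ^ 2) + K) + Y ^ 2 * X ^ 4 * L) :
    T ≤ 2 ^ 15 * Ar * Yr * Xr ^ 2 * Lr := by
  have hAr0 := hA.trans hAr
  have hXr0 := hX.trans hXr
  have hYr0 := hY.trans hYr
  have hHr0 := hH.trans hHr
  have hLr0 := hL.trans hLr
  have h1' : M2 ^ 2 ≤ 45 * Hr * Yr ^ 2 * Xr ^ 5 * Lr ^ 2 := h1.trans (by gcongr)
  have h2' : K ^ 2 ≤ (3 * Hr) * (3 * Hr * Yr * (2 * Lr * Xr ^ 2) + M2) * (2 * Lr * Xr ^ 2) :=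
    h2.trans (by gcongr)
  have h3' : T ≤ Ar * (Yr * (2 * Lr * Xr ^ 2) + K) + Yr ^ 2 * Xr ^ 4 * Lr := h3.trans (by gcongr)
  have e1 : Hr * M2 ≤ 2 ^ 14 * (Yr ^ 2 * Xr ^ 2 * Lr) := by
    refine (pow_le_pow_iff_left₀ (by positivity) (by positivity) two_ne_zero).1 ?_
    calc (Hr * M2) ^ 2 = Hr ^ 2 * M2 ^ 2 := by ring
      _ ≤ Hr ^ 2 * (45 * Hr * Yr ^ 2 * Xr ^ 5 * Lr ^ 2) := by gcongr
      _ = (Hr ^ 3 * Xr) * (45 * Yr ^ 2 * Xr ^ 4 * Lr ^ 2) := by ring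
      _ ≤ (2 ^ 21 * Yr ^ 2) * (45 * Yr ^ 2 * Xr ^ 4 * Lr ^ 2) := by gcongr
      _ = (2 ^ 21 * 45) * (Yr ^ 2 * Xr ^ 2 * Lr) ^ 2 := by ring
      _ ≤ (2 ^ 28) * (Yr ^ 2 * Xr ^ 2 * Lr) ^ 2 := by gcongr; norm_num
      _ = _ := by ring
  have e2 : K ≤ 2 ^ 14 * (Yr * Xr ^ 2 * Lr) := by
    refine (pow_le_pow_iff_left₀ (by positivity) (by positivity) two_ne_zero).1 ?_
    calc K ^ 2 ≤ _ := h2'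
      _ = (18 * Hr ^ 2 * (Yr * Lr * Xr ^ 2) + 3 * (Hr * M2)) * (2 * Lr * Xr ^ 2) := by ring
      _ ≤ (18 * (2 ^ 21 * Yr) * (Yr * Lr * Xr ^ 2) + 3 * (2 ^ 14 * (Yr ^ 2 * Xr ^ 2 * Lr))) * (2 * Lr * Xr ^ 2) := by
          gcongr
      _ = (18 * 2 ^ 22 + 6 * 2 ^ 14) * (Yr * Xr ^ 2 * Lr) ^ 2 := by ring
      _ ≤ (2 ^ 28) * (Yr * Xr ^ 2 * Lr) ^ 2 := by gcongr; norm_num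
      _ = _ := by ring
  calc T ≤ _ := h3'
    _ ≤ Ar * (Yr * (2 * Lr * Xr ^ 2) + 2 ^ 14 * (Yr * Xr ^ 2 * Lr)) + (Yr * Xr ^ 2) * (Yr * Xr ^ 2 * Lr) := by
        have : Yr ^ 2 * Xr ^ 4 * Lr = (Yr * Xr ^ 2) * (Yr * Xr ^ 2 * Lr) := by ring
        rw [this]
        gcongr
    _ ≤ Ar * (Yr * (2 * Lr * Xr ^ 2) + 2 ^ 14 * (Yr * Xr ^ 2 * Lr)) + Ar * (Yr * Xr ^ 2 * Lr) := by
        gcongr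
    _ = (3 + 2 ^ 14) * Ar * Yr * Xr ^ 2 * Lr := by ring
    _ ≤ _ := by gcongr; norm_num

theorem e_eq (a : ℝ) (N : ℤ) : e (a * N) = Complex.exp ((2 * Real.pi * Complex.I * N) * a) := by
  unfold e; congr 1; push_cast; ring

theorem e_add (a b : ℝ) : e (a + b) = e a * e b := by
  unfold e; rw [← Complex.exp_add]; congr 1; push_cast; ring

theorem e_conj (a : ℝ) : (starRingEnd ℂ) (e a) = e (-a) := by
  unfold e; rw [← Complex.exp_conj]; congr 1; simp [map_ofNat]

theorem e_cont (N : ℤ) : Continuous (fun a : ℝ => e (a * N)) := by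
  simp only [e_eq]; fun_prop

theorem int_e (N : ℤ) : ∫ a in (0 : ℝ)..1, e (a * N) = if N = 0 then 1 else 0 := by
  simp only [e_eq]
  split_ifs with h
  · simp [h]
  · have hc : (2 * Real.pi * Complex.I * N : ℂ) ≠ 0 := by
      simp [h, Real.pi_ne_zero]
    rw [integral_exp_mul_complex hc]
    have : Complex.exp (2 * Real.pi * Complex.I * N * (1 : ℝ)) = 1 := by
      rw [Complex.exp_eq_one_iff]; exact ⟨N, by push_cast; ring⟩
    rw [this]; simp

theorem int_sq {ι : Type*} (I : Finset ι) (wt : ι → ℝ) (W : ℝ) (N : ι → ℤ) (hw0 : ∀ i ∈ I, 0 ≤ wt i)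
    (hW : ∀ i ∈ I, wt i ≤ W) :
    ∫ a in (0 : ℝ)..1, ‖∑ i ∈ I, e (a * N i) * (wt i : ℂ)‖ ^ 2 ≤
      W ^ 2 * ((I ×ˢ I).filter (fun z => N z.1 = N z.2)).card := by
  have h1 : ((∫ a in (0 : ℝ)..1, ‖∑ i ∈ I, e (a * N i) * (wt i : ℂ)‖ ^ 2 : ℝ) : ℂ) =
      ((∑ z ∈ I ×ˢ I, if N z.1 = N z.2 then wt z.1 * wt z.2 else 0 : ℝ) : ℂ) := by
    rw [← intervalIntegral.integral_ofReal]
    have h2 : ∀ a : ℝ, ((‖∑ i ∈ I, e (a * N i) * (wt i : ℂ)‖ ^ 2 : ℝ) : ℂ) =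
        ∑ z ∈ I ×ˢ I, ((wt z.1 * wt z.2 : ℝ) : ℂ) * e (a * ((N z.1 - N z.2 : ℤ) : ℝ)) := by
      intro a
      push_cast
      rw [← Complex.mul_conj', map_sum, Finset.sum_mul_sum, Finset.sum_product]
      refine Finset.sum_congr rfl fun i _ => Finset.sum_congr rfl fun j _ => ?_
      rw [map_mul, e_conj, Complex.conj_ofReal, show a * ((N i : ℝ) - N j) = a * N i + -(a * N j) by ring, e_add]
      ring
    simp only [h2]
    rw [intervalIntegral.integral_finsetSum]
    · push_cast
      refine Finset.sum_congr rfl fun z _ => ?_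
      rw [intervalIntegral.integral_const_mul, ← Int.cast_sub, int_e]
      simp only [sub_eq_zero]
      split_ifs <;> simp
    · intro z _
      exact (Continuous.intervalIntegrable (continuous_const.mul (e_cont _)) _ _)
  have h2 := Complex.ofReal_injective h1
  rw [h2, ← Finset.sum_filter, mul_comm, ← nsmul_eq_mul]
  apply Finset.sum_le_card_nsmul
  intro z hz
  rw [mem_filter, mem_product] at hz
  rw [sq]
  exact mul_le_mul (hW _ hz.1.1) (hW _ hz.1.2) (hw0 _ hz.1.2) ((hw0 _ hz.1.1).trans (hW _ hz.1.1))

theorem card_le_floor (S : Finset ℕ) (x : ℝ) (h1 : ∀ p ∈ S, 1 ≤ p) (h2 : ∀ p ∈ S, (p : ℝ) ≤ x) :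
    S.card ≤ ⌊x⌋₊ := by
  calc S.card ≤ (Finset.Icc 1 ⌊x⌋₊).card := Finset.card_le_card (by
        intro p hp
        rw [mem_Icc]
        exact ⟨h1 p hp, Nat.le_floor (h2 p hp)⟩)
    _ = _ := by simp

theorem sep_real (k : ℕ) (hk : 1 ≤ k) (Y D : ℝ) (hY : 0 < Y) (x y : ℝ) (hx : Y / 2 < x) (hy : Y / 2 < y)
    (hxy : y ≤ x) (h : x ^ k - y ^ k ≤ 2 * D) : x - y ≤ 2 ^ k * (D / Y ^ (k - 1)) := by
  obtain ⟨j, rfl⟩ : ∃ j, k = j + 1 := ⟨k - 1, by omega⟩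
  have hy0 : 0 < y := by linarith
  have h1 : (x - y) * (Y / 2) ^ j ≤ x ^ (j + 1) - y ^ (j + 1) := by
    have a1 : (Y / 2) ^ j ≤ x ^ j := pow_le_pow_left₀ (by linarith) hx.le _
    have a2 : y ^ j ≤ x ^ j := pow_le_pow_left₀ hy0.le hxy _
    have a3 : (x - y) * (Y / 2) ^ j ≤ (x - y) * x ^ j := mul_le_mul_of_nonneg_left a1 (by linarith)
    have a4 : y * y ^ j ≤ y * x ^ j := mul_le_mul_of_nonneg_left a2 hy0.le
    rw [pow_succ, pow_succ]
    nlinarith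
  have h2 : (x - y) * (Y / 2) ^ j ≤ 2 * D := h1.trans h
  simp only [Nat.add_sub_cancel]
  rw [div_pow, mul_div_assoc', div_le_iff₀ (by positivity)] at h2
  rw [mul_div_assoc', le_div_iff₀ (by positivity), pow_succ]
  linarith

theorem expand (A2 Q G : Finset ℕ) (k : ℕ) (a : ℝ) :
    (∑ p ∈ A2, e (a * (p : ℝ) ^ 2) * (Real.log p : ℂ)) * (∑ p ∈ Q, e (a * (p : ℝ) ^ k) * (Real.log p : ℂ)) *
      ((∑ p ∈ G, e (a * (p : ℝ) ^ 5) * (Real.log p : ℂ)) * (∑ p ∈ G, e (a * (p : ℝ) ^ 5) * (Real.log p : ℂ))) =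
    ∑ i ∈ (A2 ×ˢ Q) ×ˢ (G ×ˢ G), e (a * (((i.1.1 : ℤ) ^ 2 + (i.1.2 : ℤ) ^ k +
      ((i.2.1 : ℤ) ^ 5 + (i.2.2 : ℤ) ^ 5) : ℤ) : ℝ)) *
      ((Real.log i.1.1 * Real.log i.1.2 * (Real.log i.2.1 * Real.log i.2.2) : ℝ) : ℂ) := by
  rw [Finset.sum_mul_sum, Finset.sum_mul_sum, ← Finset.sum_product', ← Finset.sum_product', Finset.sum_mul_sum,
    ← Finset.sum_product']
  refine Finset.sum_congr rfl fun i _ => ?_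
  push_cast
  rw [mul_add, mul_add, mul_add, e_add, e_add, e_add]
  ring

/-- The count for the sets at hand. -/
theorem count_bound (c : ℕ) (hc : c = 6 ∨ c = 7) (n : ℕ) (hn : 1 ≤ n) (Lr : ℝ) (hLr1 : 1 ≤ Lr)
    (hL : ∀ d : ℤ, d ≠ 0 → d.natAbs ≤ 4 * n → ((Tau d : ℕ) : ℝ) ^ 2 ≤ Lr) (A2 Q G : Finset ℕ)
    (hA2 : ∀ p ∈ A2, 1 ≤ p ∧ (p : ℝ) ≤ P n 2)
    (hQ : ∀ p ∈ Q, 1 ≤ p ∧ P n c / 2 < (p : ℝ) ∧ (p : ℝ) ≤ P n c)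
    (hG : ∀ p ∈ G, 1 ≤ p ∧ (p : ℝ) ≤ P n 5 ^ θ c) :
    (((((A2 ×ˢ Q) ×ˢ (G ×ˢ G)) ×ˢ ((A2 ×ˢ Q) ×ˢ (G ×ˢ G))).filter (fun z =>
        (z.1.1.1 : ℤ) ^ 2 + (z.1.1.2 : ℤ) ^ c + ((z.1.2.1 : ℤ) ^ 5 + (z.1.2.2 : ℤ) ^ 5) =
        (z.2.1.1 : ℤ) ^ 2 + (z.2.1.2 : ℤ) ^ c + ((z.2.2.1 : ℤ) ^ 5 + (z.2.2.2 : ℤ) ^ 5))).card : ℝ) ≤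
      2 ^ 15 * P n 2 * P n c * (P n 5 ^ θ c) ^ 2 * Lr := by
  have hn1 : (1 : ℝ) ≤ n := by exact_mod_cast hn
  have hn0 : (0 : ℝ) < n := by linarith
  have hk2 : P2 c := by rcases hc with rfl | rfl; exacts [P2_6, P2_7]
  have hk3 : P3 c := by rcases hc with rfl | rfl; exacts [P3_6, P3_7]
  have hcpos : 1 ≤ c := by omega
  have hθ1 : θ c ≤ 1 := by unfold θ; split_ifs <;> norm_num
  have hθ0 : 0 ≤ θ c := by unfold θ; split_ifs <;> norm_num
  have hX : P n 5 ^ θ c = (n : ℝ) ^ (θ c / 5) := by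
    unfold P; rw [← Real.rpow_mul hn0.le]; congr 1; push_cast; ring
  have hYe : P n c = (n : ℝ) ^ ((c : ℝ)⁻¹) := rfl
  have hAe : P n 2 = (n : ℝ) ^ ((2 : ℝ)⁻¹) := by unfold P; norm_num
  set Xr := P n 5 ^ θ c with hXr
  set Yr := P n c with hYr
  set κ : ℝ := θ c - 1 + (c : ℝ)⁻¹ with hκ
  set Hr : ℝ := 2 ^ c * (n : ℝ) ^ κ with hHr
  have hκ0 : 0 ≤ κ := by
    rcases hc with rfl | rfl <;> simp only [hκ, θ] <;> norm_num
  have hX1 : 1 ≤ Xr := by rw [hX]; exact Real.one_le_rpow hn1 (by positivity)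
  have hY1 : 1 ≤ Yr := by rw [hYe]; exact Real.one_le_rpow hn1 (by positivity)
  have hH1 : 1 ≤ Hr := by
    have h1 : 1 ≤ (n : ℝ) ^ κ := Real.one_le_rpow hn1 hκ0
    have h2 : (1 : ℝ) ≤ 2 ^ c := one_le_pow₀ (by norm_num)
    exact one_le_mul_of_one_le_of_one_le h2 h1
  have hX5 : Xr ^ 5 = (n : ℝ) ^ θ c := by
    rw [hX, ← Real.rpow_natCast, ← Real.rpow_mul hn0.le]; congr 1; push_cast; ring
  have hYc : Yr ^ c = n := by
    rw [hYe, ← Real.rpow_natCast, ← Real.rpow_mul hn0.le, inv_mul_cancel₀ (by positivity), Real.rpow_one]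
  have hHdef : Xr ^ 5 / Yr ^ (c - 1) = (n : ℝ) ^ κ := by
    rw [hX5, hYe, ← Real.rpow_natCast, ← Real.rpow_mul hn0.le, ← Real.rpow_sub hn0]
    congr 1
    rw [Nat.cast_sub hcpos, hκ]
    have : (c : ℝ) ≠ 0 := by positivity
    field_simp
    push_cast
    ring
  have hXfl : (⌊Xr⌋₊ : ℝ) ≤ Xr := Nat.floor_le (by linarith)
  have hfl : ∀ x : ℝ, 1 ≤ x → 1 ≤ ⌊x⌋₊ := fun x hx => Nat.le_floor (by simpa using hx)
  obtain ⟨M2, K, h1, h2, h3⟩ := total hk2 hk3 A2 G Q n ⌊Lr⌋₊ ⌊Xr⌋₊ ⌊Yr⌋₊ ⌊Hr⌋₊ (hfl _ hLr1) (hfl _ hX1) (hfl _ hH1)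
    (fun d h0 hd => Nat.le_floor (by push_cast; exact hL d h0 hd))
    (by
      have : ((⌊Xr⌋₊ ^ 5 : ℕ) : ℝ) ≤ n := by
        push_cast
        calc (⌊Xr⌋₊ : ℝ) ^ 5 ≤ Xr ^ 5 := by gcongr
          _ = (n : ℝ) ^ θ c := hX5
          _ ≤ (n : ℝ) ^ (1 : ℝ) := Real.rpow_le_rpow_of_exponent_le hn1 hθ1
          _ = n := Real.rpow_one _
      exact_mod_cast this)
    (fun r hr => Nat.le_floor (hG r hr).2)
    (card_le_floor G Xr (fun r hr => (hG r hr).1) (fun r hr => (hG r hr).2))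
    (fun q hq => by
      have : ((q ^ c : ℕ) : ℝ) ≤ n := by
        push_cast
        calc (q : ℝ) ^ c ≤ Yr ^ c := by gcongr; exact (hQ q hq).2.2
          _ = n := hYc
      exact_mod_cast this)
    (card_le_floor Q Yr (fun r hr => (hQ r hr).1) (fun r hr => (hQ r hr).2.2))
    (by
      have key : ∀ x ∈ Q, ∀ y ∈ Q, y ≤ x → ((x : ℤ) ^ c - (y : ℤ) ^ c).natAbs ≤ 2 * ⌊Xr⌋₊ ^ 5 →
          ((x : ℤ) - y).natAbs ≤ ⌊Hr⌋₊ := by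
        intro x hx y hy hxy h
        have hpow : y ^ c ≤ x ^ c := Nat.pow_le_pow_left hxy c
        have h1 : (x : ℤ) ^ c - (y : ℤ) ^ c ≤ ((2 * ⌊Xr⌋₊ ^ 5 : ℕ) : ℤ) := by
          have := Int.le_natAbs (a := (x : ℤ) ^ c - (y : ℤ) ^ c)
          omega
        have h2 : (x : ℝ) ^ c - (y : ℝ) ^ c ≤ 2 * Xr ^ 5 := by
          have h3 : (x : ℝ) ^ c - (y : ℝ) ^ c ≤ 2 * (⌊Xr⌋₊ : ℝ) ^ 5 := by exact_mod_cast h1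
          have h4 : (⌊Xr⌋₊ : ℝ) ^ 5 ≤ Xr ^ 5 := by gcongr
          linarith
        have h3 := sep_real c hcpos Yr (Xr ^ 5) (by linarith) x y (hQ x hx).2.1 (hQ y hy).2.1
          (by exact_mod_cast hxy) h2
        rw [hHdef] at h3
        apply Nat.le_floor
        have : ((((x : ℤ) - y).natAbs : ℕ) : ℝ) = (x : ℝ) - y := by
          have h5 : ((((x : ℤ) - y).natAbs : ℕ) : ℤ) = (x : ℤ) - y := Int.natAbs_of_nonneg (by omega)
          exact_mod_cast h5
        rw [this]
        exact h3
      rintro ⟨x, y⟩ hq h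
      rw [mem_product] at hq
      unfold pw at h
      unfold df
      simp only at h ⊢
      rcases le_total y x with hxy | hxy
      · exact key x hq.1 y hq.2 hxy h
      · have := key y hq.2 x hq.1 hxy (by rw [← Int.natAbs_neg, neg_sub]; exact h)
        omega)
  have c1 : Hr ^ 2 ≤ 2 ^ 21 * Yr := by
    have : Hr ^ 2 = (2 ^ c) ^ 2 * (n : ℝ) ^ (κ * 2) := by
      rw [hHr, mul_pow, Real.rpow_mul hn0.le]; norm_cast
    rw [this, hYe]
    apply mul_le_mul _ _ (by positivity) (by positivity)
    · rcases hc with rfl | rfl <;> norm_num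
    · apply Real.rpow_le_rpow_of_exponent_le hn1
      rcases hc with rfl | rfl <;> simp only [hκ, θ] <;> norm_num
  have c2 : Hr ^ 3 * Xr ≤ 2 ^ 21 * Yr ^ 2 := by
    have e1 : Hr ^ 3 * Xr = (2 ^ c) ^ 3 * (n : ℝ) ^ (κ * 3 + θ c / 5) := by
      rw [hHr, mul_pow, Real.rpow_add hn0 (κ * 3) (θ c / 5), Real.rpow_mul hn0.le κ 3, hX, mul_assoc]; norm_cast
    have e2 : Yr ^ 2 = (n : ℝ) ^ ((c : ℝ)⁻¹ * 2) := by
      rw [hYe, Real.rpow_mul hn0.le]; norm_cast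
    rw [e1, e2]
    apply mul_le_mul _ _ (by positivity) (by positivity)
    · rcases hc with rfl | rfl <;> norm_num
    · apply Real.rpow_le_rpow_of_exponent_le hn1
      rcases hc with rfl | rfl <;> simp only [hκ, θ] <;> norm_num
  have c3 : Yr * Xr ^ 2 ≤ P n 2 := by
    have e2 : Xr ^ 2 = (n : ℝ) ^ (θ c / 5 * 2) := by
      rw [hX, Real.rpow_mul hn0.le]; norm_cast
    rw [e2, hYe, ← Real.rpow_add hn0, hAe]
    apply Real.rpow_le_rpow_of_exponent_le hn1
    rcases hc with rfl | rfl <;> simp only [θ] <;> norm_num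
  have hA0 : 0 ≤ P n 2 := by unfold P; positivity
  refine total_num A2.card ⌊Xr⌋₊ ⌊Yr⌋₊ ⌊Hr⌋₊ ⌊Lr⌋₊ _ M2 K (P n 2) Xr Yr Hr Lr (by positivity) (by positivity)
    (by positivity) (by positivity) (by positivity) (by positivity) (by positivity) ?_ hXfl
    (Nat.floor_le (by linarith)) (Nat.floor_le (by linarith)) (Nat.floor_le (by linarith)) c1 c2 c3
    (by exact_mod_cast h1) (by exact_mod_cast h2) (by exact_mod_cast h3)
  calc (A2.card : ℝ) ≤ ⌊P n 2⌋₊ := by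
        exact_mod_cast card_le_floor A2 _ (fun r hr => (hA2 r hr).1) (fun r hr => (hA2 r hr).2)
    _ ≤ _ := Nat.floor_le hA0

/-- The mean value bound `J_{1,c} = ∫_0^1 |f_2 f_c|² |f_{5,c}|⁴ dα ≪ P_2^{1+ε} P_c P_5^{2θ_c}`. -/
theorem J1_bound (c : ℕ) (hc : c = 6 ∨ c = 7) (ε : ℝ) (hε : 0 < ε) :
    ∃ C : ℝ, 0 < C ∧ ∃ N : ℕ, ∀ n : ℕ, N ≤ n →
      (∫ α in (0 : ℝ)..1, ‖f n 2 α * f n c α‖ ^ 2 * ‖f5 n c α‖ ^ 4) ≤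
        C * P n 2 ^ (1 + ε) * P n c * P n 5 ^ (2 * θ c) := by
  obtain ⟨D, hD1, hD⟩ := div_bound (ε / 8) (by positivity)
  set s : ℝ := ε / 32 with hs
  have hs0 : 0 < s := by positivity
  set D' : ℝ := (2 * D) ^ 2 * (4 : ℝ) ^ (ε / 4) with hD'
  have hD'1 : 1 ≤ D' := by
    have h1 : (1 : ℝ) ≤ (2 * D) ^ 2 := one_le_pow₀ (by linarith)
    have h2 : (1 : ℝ) ≤ (4 : ℝ) ^ (ε / 4) := Real.one_le_rpow (by norm_num) (by positivity)
    exact one_le_mul_of_one_le_of_one_le h1 h2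
  refine ⟨(1 / s) ^ 8 * (2 ^ 15 * D'), by positivity, 1, fun n hn => ?_⟩
  have hn1 : (1 : ℝ) ≤ n := by exact_mod_cast hn
  have hn0 : (0 : ℝ) < n := by linarith
  have hlog0 : 0 ≤ Real.log n := Real.log_nonneg hn1
  set A2 := (Finset.range (n + 1)).filter
      (fun p : ℕ => p.Prime ∧ P n 2 / 2 < (p : ℝ) ∧ (p : ℝ) ≤ P n 2) with hA2
  set Qs := (Finset.range (n + 1)).filter
      (fun p : ℕ => p.Prime ∧ P n c / 2 < (p : ℝ) ∧ (p : ℝ) ≤ P n c) with hQs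
  set G := (Finset.range (n + 1)).filter
      (fun p : ℕ => p.Prime ∧ 1 < (p : ℝ) ∧ (p : ℝ) ≤ P n 5 ^ θ c) with hG
  have hlog : ∀ p : ℕ, p ∈ Finset.range (n + 1) → p.Prime → 0 ≤ Real.log p ∧ Real.log p ≤ Real.log n := by
    intro p hp hpr
    have h1 : (1 : ℝ) ≤ p := by exact_mod_cast hpr.one_lt.le
    refine ⟨Real.log_nonneg h1, Real.log_le_log (by linarith) ?_⟩
    rw [mem_range] at hp
    exact_mod_cast Nat.lt_succ_iff.1 hp
  have lA : ∀ p ∈ A2, 0 ≤ Real.log p ∧ Real.log p ≤ Real.log n := fun p hp => by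
    rw [hA2, mem_filter] at hp; exact hlog p hp.1 hp.2.1
  have lQ : ∀ p ∈ Qs, 0 ≤ Real.log p ∧ Real.log p ≤ Real.log n := fun p hp => by
    rw [hQs, mem_filter] at hp; exact hlog p hp.1 hp.2.1
  have lG : ∀ p ∈ G, 0 ≤ Real.log p ∧ Real.log p ≤ Real.log n := fun p hp => by
    rw [hG, mem_filter] at hp; exact hlog p hp.1 hp.2.1
  have hintegrand : ∀ α : ℝ, ‖f n 2 α * f n c α‖ ^ 2 * ‖f5 n c α‖ ^ 4 =
      ‖∑ i ∈ (A2 ×ˢ Qs) ×ˢ (G ×ˢ G), e (α * (((i.1.1 : ℤ) ^ 2 + (i.1.2 : ℤ) ^ c +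
      ((i.2.1 : ℤ) ^ 5 + (i.2.2 : ℤ) ^ 5) : ℤ) : ℝ)) *
      ((Real.log i.1.1 * Real.log i.1.2 * (Real.log i.2.1 * Real.log i.2.2) : ℝ) : ℂ)‖ ^ 2 := by
    intro α
    rw [← expand A2 Qs G c α]
    have e1 : f n 2 α = ∑ p ∈ A2, e (α * (p : ℝ) ^ 2) * (Real.log p : ℂ) := rfl
    have e2 : f n c α = ∑ p ∈ Qs, e (α * (p : ℝ) ^ c) * (Real.log p : ℂ) := rfl
    have e3 : f5 n c α = ∑ p ∈ G, e (α * (p : ℝ) ^ 5) * (Real.log p : ℂ) := rfl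
    rw [← e1, ← e2, ← e3, norm_mul _ (f5 n c α * f5 n c α), norm_mul (f5 n c α)]
    ring
  simp only [hintegrand]
  have hwt : ∀ i ∈ (A2 ×ˢ Qs) ×ˢ (G ×ˢ G),
      0 ≤ Real.log i.1.1 * Real.log i.1.2 * (Real.log i.2.1 * Real.log i.2.2) ∧
      Real.log i.1.1 * Real.log i.1.2 * (Real.log i.2.1 * Real.log i.2.2) ≤ Real.log n ^ 4 := by
    intro i hi
    simp only [mem_product] at hi
    obtain ⟨a1, a2⟩ := lA _ hi.1.1
    obtain ⟨b1, b2⟩ := lQ _ hi.1.2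
    obtain ⟨c1, c2⟩ := lG _ hi.2.1
    obtain ⟨d1, d2⟩ := lG _ hi.2.2
    refine ⟨by positivity, ?_⟩
    calc _ ≤ Real.log n * Real.log n * (Real.log n * Real.log n) := by gcongr
      _ = _ := by ring
  refine (int_sq _ (fun i : (ℕ × ℕ) × (ℕ × ℕ) => Real.log i.1.1 * Real.log i.1.2 * (Real.log i.2.1 * Real.log i.2.2))
    (Real.log n ^ 4) (fun i : (ℕ × ℕ) × (ℕ × ℕ) => (i.1.1 : ℤ) ^ 2 + (i.1.2 : ℤ) ^ c +
      ((i.2.1 : ℤ) ^ 5 + (i.2.2 : ℤ) ^ 5)) (fun i hi => (hwt i hi).1) (fun i hi => (hwt i hi).2)).trans ?_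
  have hLr1 : 1 ≤ D' * (n : ℝ) ^ (ε / 4) :=
    one_le_mul_of_one_le_of_one_le hD'1 (Real.one_le_rpow hn1 (by positivity))
  have hcb := count_bound c hc n hn (D' * (n : ℝ) ^ (ε / 4)) hLr1 (by
      intro d h0 hd
      have h1 := hD d.natAbs (by simpa using h0)
      have h2 : (d.natAbs : ℝ) ≤ 4 * n := by exact_mod_cast hd
      have h3 : ((d.natAbs : ℝ)) ^ (ε / 8) ≤ (4 * n : ℝ) ^ (ε / 8) :=
        Real.rpow_le_rpow (by positivity) h2 (by positivity)
      have h4 : ((Tau d : ℕ) : ℝ) ≤ 2 * D * (4 * n : ℝ) ^ (ε / 8) := by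
        unfold Tau
        push_cast
        have : D * ((d.natAbs : ℝ)) ^ (ε / 8) ≤ D * (4 * n : ℝ) ^ (ε / 8) :=
          mul_le_mul_of_nonneg_left h3 (by linarith)
        linarith
      calc ((Tau d : ℕ) : ℝ) ^ 2 ≤ (2 * D * (4 * n : ℝ) ^ (ε / 8)) ^ 2 := by gcongr
        _ = (2 * D) ^ 2 * ((4 * n : ℝ) ^ (ε / 8)) ^ 2 := by ring
        _ = (2 * D) ^ 2 * ((4 * n : ℝ) ^ (ε / 4)) := by
            rw [← Real.rpow_natCast ((4 * n : ℝ) ^ (ε / 8)), ← Real.rpow_mul (by positivity)]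
            congr 2; push_cast; ring
        _ = _ := by rw [Real.mul_rpow (by norm_num) hn0.le, hD']; ring)
    A2 Qs G
    (fun p hp => by rw [hA2, mem_filter] at hp; exact ⟨hp.2.1.one_lt.le, hp.2.2.2⟩)
    (fun p hp => by rw [hQs, mem_filter] at hp; exact ⟨hp.2.1.one_lt.le, hp.2.2⟩)
    (fun p hp => by rw [hG, mem_filter] at hp; exact ⟨hp.2.1.one_lt.le, hp.2.2.2⟩)
  have hlogb : Real.log n ^ 8 ≤ (1 / s) ^ 8 * (n : ℝ) ^ (ε / 4) := by
    have h1 := Real.log_le_rpow_div hn0.le hs0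
    calc Real.log n ^ 8 ≤ ((n : ℝ) ^ s / s) ^ 8 := by gcongr
      _ = (1 / s) ^ 8 * ((n : ℝ) ^ s) ^ 8 := by ring
      _ = _ := by
        rw [← Real.rpow_natCast ((n : ℝ) ^ s), ← Real.rpow_mul hn0.le]
        congr 2; rw [hs]; push_cast; ring
  have hPc : 0 ≤ P n c := by unfold P; positivity
  have hP2 : 0 ≤ P n 2 := by unfold P; positivity
  have hP5 : 0 ≤ P n 5 := by unfold P; positivity
  have e5 : P n 5 ^ (2 * θ c) = (P n 5 ^ θ c) ^ 2 := by
    rw [mul_comm, Real.rpow_mul hP5]; norm_cast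
  have e2 : P n 2 ^ (1 + ε) = P n 2 * ((n : ℝ) ^ (ε / 4) * (n : ℝ) ^ (ε / 4)) := by
    have hp : 0 < P n 2 := by unfold P; positivity
    rw [Real.rpow_add hp, Real.rpow_one, ← Real.rpow_add hn0]
    congr 1
    unfold P
    rw [← Real.rpow_mul hn0.le]
    congr 1; push_cast; ring
  rw [e5, e2, show (Real.log n ^ 4) ^ 2 = Real.log n ^ 8 by ring]
  calc _ ≤ ((1 / s) ^ 8 * (n : ℝ) ^ (ε / 4)) *
        (2 ^ 15 * P n 2 * P n c * (P n 5 ^ θ c) ^ 2 * (D' * (n : ℝ) ^ (ε / 4))) :=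
        mul_le_mul hlogb hcb (by positivity) (by positivity)
    _ = _ := by ring
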